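/- For every positive integer χ there are arbitrarily large N for which there exist an N-vertex tournament T and disjoint subsets A, B of V(T) such that χ(T[A]) ≥ χ and χ(T[B]) ≥ χ, and for all A' ⊆ A and B' ⊆ B of size at most (log N)/(32χ²), both χ(T[A ∩ N⁺_T(B')]) ≤ 2 and χ(T[B ∩ N⁺_T(A')]) ≤ 2. -/

import Mathlib

/-- A tournament on `V`: an orientation of the complete graph, i.e. an irreflexive
relation such that for distinct vertices exactly one direction is present. -/
def IsTournament {V : Type*} (r : V → V → Prop) : Prop :=
  (∀ v, ¬ r v v) ∧ ∀ u v : V, u ≠ v → (r u v ↔ ¬ r v u)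

/-- The relation `r` is transitive on the set `W`; for a tournament this says that
the subtournament induced on `W` is transitive (acyclic). -/
def TransOn {V : Type*} (r : V → V → Prop) (W : Set V) : Prop :=
  ∀ u ∈ W, ∀ v ∈ W, ∀ w ∈ W, r u v → r v w → r u w

/-- The chromatic number of the subtournament of `r` induced on `W`: the least `m`
such that `W` can be partitioned into `m` parts, each inducing a transitive
subtournament. -/
noncomputable def tournChromOn {V : Type*} (r : V → V → Prop) (W : Set V) : ℕ :=
  sInf {m : ℕ | ∃ c : V → Fin m, ∀ i : Fin m, TransOn r {v ∈ W | c v = i}}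



/-- alternating sign lists -/
def AltL : Bool → List Bool → Prop
  | _, [] => True
  | b, c :: t => c = b ∧ AltL (!b) t

open Classical in
noncomputable def altI (b : Bool) (l : List Bool) : ZMod 2 := if AltL b l then 1 else 0

lemma altI_cons (b c : Bool) (t : List Bool) :
    altI b (c :: t) = if c = b then altI (!b) t else 0 := by
  unfold altI
  by_cases h : c = b
  · subst h; rw [if_pos rfl]; congr 1; simp [AltL]
  · simp [AltL, h]

abbrev Lbl := ℕ ×ₗ Bool

def sg (a : Lbl) : Bool := (ofLex a).2

lemma zz (a : ZMod 2) : a + a = 0 := CharTwo.add_self_eq_zero a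

lemma erase_cons_sorted (c a : Lbl) (t : List Lbl) (h : (c :: t).Pairwise (· ≤ ·)) (ha : a ∈ t) :
    (c :: t).erase a = c :: t.erase a := by
  by_cases hac : c = a
  · subst hac
    cases t with
    | nil => simp at ha
    | cons h0 t' =>
      have h1 : c ≤ h0 := by simp at h; exact h.1.1
      have h2 : h0 ≤ c := by
        rw [List.pairwise_cons] at h
        rcases List.mem_cons.1 ha with h3 | h3
        · exact h3.ge
        · exact (List.pairwise_cons.1 h.2).1 _ h3
      have : c = h0 := le_antisymm h1 h2
      subst this
      simp
  · rw [List.erase_cons_tail]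
    simpa using hac

lemma altSum (l : List Lbl) (h : l.Pairwise (· ≤ ·)) : ∀ b,
    (l.map (fun a => altI b ((l.erase a).map sg))).sum = altI b (l.map sg) + altI (!b) (l.map sg) := by
  induction l with
  | nil => intro b; simp [altI, AltL]; rfl
  | cons c t ih =>
    intro b
    have ih' := ih (List.pairwise_cons.1 h).2
    have e : t.map (fun a => altI b (((c :: t).erase a).map sg))
        = t.map (fun a => if sg c = b then altI (!b) ((t.erase a).map sg) else 0) := by
      apply List.map_congr_left
      intro a ha
      rw [erase_cons_sorted c a t h ha, List.map_cons, altI_cons]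
    rw [List.map_cons, List.sum_cons, e, List.erase_cons_head, List.map_cons, altI_cons, altI_cons]
    by_cases hc : sg c = b
    · simp only [hc, if_true]
      rw [ih' (!b)]
      have : ¬ (b = !b) := by cases b <;> simp
      simp only [this, if_false, Bool.not_not]
      linear_combination zz (altI b (t.map sg))
    · have : sg c = !b := by revert hc; cases sg c <;> cases b <;> simp
      simp [this]

/-- indicator on multisets of labels -/
noncomputable def altM (b : Bool) (m : Multiset Lbl) : ZMod 2 := altI b ((m.sort (· ≤ ·)).map sg)

lemma altM_sum (b : Bool) (m : Multiset Lbl) :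
    (m.map (fun a => altM b (m.erase a))).sum = altM b m + altM (!b) m := by
  unfold altM
  rw [← altSum _ (Multiset.pairwise_sort m (· ≤ ·)) b]
  conv_lhs => enter [1]; rw [← Multiset.sort_eq m (· ≤ ·)]
  rw [Multiset.map_coe, Multiset.sum_coe]
  congr 1
  apply List.map_congr_left
  intro a ha
  congr 2
  apply List.Perm.eq_of_pairwise' (r := (· ≤ ·))
  · exact Multiset.pairwise_sort _ _
  · exact List.Pairwise.sublist List.erase_sublist (Multiset.pairwise_sort m (· ≤ ·))
  · rw [← Multiset.coe_eq_coe, Multiset.sort_eq, Multiset.coe_erase]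
    congr 2
    exact lawful_beq_subsingleton _ _

def negL (a : Lbl) : Lbl := toLex ((ofLex a).1, !(ofLex a).2)

lemma altI_not (l : List Bool) : ∀ b, altI b (l.map (!·)) = altI (!b) l := by
  induction l with
  | nil => intro b; simp [altI, AltL]
  | cons c t ih =>
    intro b
    rw [List.map_cons, altI_cons, altI_cons, ih]
    cases b <;> cases c <;> simp

def NoComp (m : Multiset Lbl) : Prop := ∀ a ∈ m, ∀ b ∈ m, (ofLex a).1 = (ofLex b).1 → sg a = sg b

lemma altM_neg (b : Bool) (m : Multiset Lbl) (h : NoComp m) :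
    altM b (m.map negL) = altM (!b) m := by
  unfold altM
  rw [← altI_not]
  congr 1
  have : (m.map negL).sort (· ≤ ·) = (m.sort (· ≤ ·)).map negL := by
    apply List.Perm.eq_of_pairwise' (r := (· ≤ ·))
    · exact Multiset.pairwise_sort _ _
    · rw [List.pairwise_map]
      refine List.Pairwise.imp_of_mem ?_ (Multiset.pairwise_sort m (· ≤ ·))
      intro a b ha hb hab
      rw [Multiset.mem_sort] at ha hb
      have := h a ha b hb
      rw [Prod.Lex.le_iff] at hab ⊢
      rcases hab with h1 | ⟨h1, h2⟩
      · left; exact h1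
      · right
        refine ⟨h1, ?_⟩
        have := this h1
        simp only [sg] at this
        simp [negL, this]
    · rw [← Multiset.coe_eq_coe, Multiset.sort_eq, ← Multiset.map_coe, Multiset.sort_eq]
  rw [this, List.map_map, List.map_map]
  rfl

lemma alt_strict (l : List Lbl) (h : l.Pairwise (· ≤ ·))
    (hc : ∀ a ∈ l, ∀ b ∈ l, (ofLex a).1 = (ofLex b).1 → sg a = sg b) : ∀ b, AltL b (l.map sg) →
    l.Pairwise (fun x y => (ofLex x).1 < (ofLex y).1) := by
  induction l with
  | nil => simp
  | cons c t ih =>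
    intro b hb
    rw [List.pairwise_cons] at h
    have ht := ih h.2 (fun a ha b hb => hc a (by simp [ha]) b (by simp [hb])) (!b) hb.2
    rw [List.pairwise_cons]
    refine ⟨?_, ht⟩
    cases t with
    | nil => simp
    | cons d t' =>
      have h1 : (ofLex c).1 < (ofLex d).1 := by
        have h2 := h.1 d (by simp)
        rw [Prod.Lex.le_iff] at h2
        rcases h2 with h2 | h2
        · exact h2
        · exfalso
          have h3 := hc c (by simp) d (by simp) h2.1
          have h4 := hb.1
          have h5 := hb.2.1
          simp only [sg] at *
          rw [h5] at h3; rw [h3] at h4; cases b <;> simp at h4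
      intro a ha
      rcases List.mem_cons.1 ha with rfl | ha
      · exact h1
      · exact h1.trans ((List.pairwise_cons.1 ht).1 a ha)

lemma altM_card (b : Bool) (m : Multiset Lbl) (h : NoComp m) (M : ℕ)
    (hM : ∀ a ∈ m, (ofLex a).1 < M) (ha : altM b m ≠ 0) : Multiset.card m ≤ M := by
  unfold altM altI at ha
  have ha' : AltL b ((m.sort (· ≤ ·)).map sg) := by
    by_contra hh
    simp [hh] at ha
  have := alt_strict _ (Multiset.pairwise_sort m (· ≤ ·)) (by
    intro a ha b hb; rw [Multiset.mem_sort] at ha hb; exact h a ha b hb) b ha'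
  have h2 : ((m.sort (· ≤ ·)).map (fun x => (ofLex x).1)).Nodup := by
    rw [List.Nodup, List.pairwise_map]
    exact this.imp (fun h => h.ne)
  have h3 := List.toFinset_card_of_nodup h2
  rw [List.length_map, Multiset.length_sort] at h3
  rw [← h3]
  calc _ ≤ (Finset.range M).card := by
        apply Finset.card_le_card
        intro j hj
        simp only [List.mem_toFinset, List.mem_map, Multiset.mem_sort] at hj
        obtain ⟨a, ha, rfl⟩ := hj
        simpa using hM a ha
    _ = M := by simp


abbrev Om (n : ℕ) := Equiv.Perm (Fin n) × (Fin n → Bool)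

def xv {n : ℕ} (w : Om n) (i : ℕ) : Fin n → SignType :=
  fun j => if (w.1.symm j).val ≤ i then (if w.2 j then 1 else -1) else 0

open Classical in
noncomputable def OmK (n k : ℕ) : Finset (Om n) :=
  Finset.univ.filter (fun w => (∀ j : Fin n, k ≤ j.val → w.1 j = j) ∧ ∀ j : Fin n, k ≤ j.val → w.2 j = true)

open Classical in
noncomputable def HK (n k : ℕ) : Finset (Om n) :=
  Finset.univ.filter (fun w => (∀ j : Fin n, k + 1 ≤ j.val → w.1 j = j) ∧
    ∀ j : Fin n, k ≤ j.val → w.2 j = true)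

noncomputable def lb {n : ℕ} (lab : (Fin n → SignType) → ℕ × Bool) (w : Om n) (i : ℕ) : Lbl :=
  toLex (lab (xv w i))

lemma xv_le {n : ℕ} (w : Om n) {i i' : ℕ} (h : i ≤ i') (j : Fin n) (hj : xv w i j ≠ 0) :
    xv w i' j = xv w i j := by
  unfold xv at *
  by_cases h1 : (w.1.symm j).val ≤ i
  · simp [h1, h1.trans h]
  · simp [h1] at hj

lemma xv_ne {n : ℕ} (hn : 0 < n) (w : Om n) (i : ℕ) : xv w i ≠ 0 := by
  intro h
  have := congrFun h (w.1 ⟨0, hn⟩)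
  simp [xv] at this
  split_ifs at this

lemma noComp_lb {n : ℕ} (hn : 0 < n) (lab : (Fin n → SignType) → ℕ × Bool)
    (hcomp : ∀ x y, x ≠ 0 → (∀ j, x j ≠ 0 → y j = x j) → (lab x).1 = (lab y).1 → (lab x).2 = (lab y).2)
    (w : Om n) (s : Multiset ℕ) : NoComp (s.map (lb lab w)) := by
  intro a ha b hb
  rw [Multiset.mem_map] at ha hb
  obtain ⟨i, _, rfl⟩ := ha
  obtain ⟨i', _, rfl⟩ := hb
  intro h
  simp only [lb, sg, ofLex_toLex] at *
  rcases le_total i i' with h1 | h1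
  · exact hcomp _ _ (xv_ne hn w i) (xv_le w h1) h
  · exact (hcomp _ _ (xv_ne hn w i') (xv_le w h1) h.symm).symm

/-- cancellation of inner faces -/
lemma swap_cancel {n k i : ℕ} (hk : k + 1 ≤ n) (hi : i < k)
    (lab : (Fin n → SignType) → ℕ × Bool) (b : Bool) :
    ∑ w ∈ HK n k, altM b (((Finset.range (k + 1)).erase i).val.map (lb lab w)) = 0 := by
  set a1 : Fin n := ⟨i, by omega⟩
  set a2 : Fin n := ⟨i + 1, by omega⟩
  have h12 : a1 ≠ a2 := by simp [a1, a2]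
  apply Finset.sum_involution (fun w _ => (w.1 * Equiv.swap a1 a2, w.2))
  · intro w hw
    have : ((Finset.range (k + 1)).erase i).val.map (lb lab (w.1 * Equiv.swap a1 a2, w.2))
        = ((Finset.range (k + 1)).erase i).val.map (lb lab w) := by
      apply Multiset.map_congr rfl
      intro i' hi'
      have hne : i' ≠ i := by
        have : i' ∈ (Finset.range (k + 1)).erase i := hi'
        exact (Finset.mem_erase.1 this).1
      have : xv (w.1 * Equiv.swap a1 a2, w.2) i' = xv w i' := by
        funext j
        have : ((w.1 * Equiv.swap a1 a2).symm j).val ≤ i' ↔ (w.1.symm j).val ≤ i' := by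
          change (Equiv.swap a1 a2 (w.1.symm j)).val ≤ i' ↔ _
          generalize w.1.symm j = z
          rw [Equiv.swap_apply_def]
          split_ifs with h1 h2
          · subst h1; simp only [a1, a2]; omega
          · subst h2; simp only [a1, a2]; omega
          · rfl
        simp only [xv, this]
      simp only [lb, this]
    rw [this]
    exact zz _
  · intro w hw _ h
    have h1 : w.1 * Equiv.swap a1 a2 = w.1 := congrArg Prod.fst h
    have h2 : Equiv.swap a1 a2 = 1 := by simpa using h1
    exact h12 (Equiv.swap_eq_one_iff.1 h2)
  · intro w hw
    simp only [HK, Finset.mem_filter, Finset.mem_univ, true_and] at hw ⊢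
    refine ⟨fun j hj => ?_, hw.2⟩
    rw [Equiv.Perm.mul_apply, Equiv.swap_apply_of_ne_of_ne, hw.1 j hj]
    · intro h; rw [h] at hj; simp only [a1] at hj; omega
    · intro h; rw [h] at hj; simp only [a2] at hj; omega
  · intro w hw
    simp [mul_assoc]

lemma last_face {n k : ℕ} (hk : k + 1 ≤ n)
    (lab : (Fin n → SignType) → ℕ × Bool) (b : Bool) :
    ∑ w ∈ HK n k, altM b (((Finset.range (k + 1)).erase k).val.map (lb lab w)) =
    ∑ w ∈ OmK n k, altM b ((Finset.range k).val.map (lb lab w)) := by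
  classical
  have er : (Finset.range (k + 1)).erase k = Finset.range k := by
    ext; simp; omega
  rw [er]
  set kk : Fin n := ⟨k, by omega⟩
  rw [← Finset.sum_filter_add_sum_filter_not _ (fun w : Om n => w.1 kk = kk)]
  have e1 : (HK n k).filter (fun w : Om n => w.1 kk = kk) = OmK n k := by
    ext w
    simp only [HK, OmK, Finset.mem_filter, Finset.mem_univ, true_and]
    constructor
    · rintro ⟨⟨h1, h2⟩, h3⟩
      refine ⟨fun j hj => ?_, h2⟩
      rcases hj.eq_or_lt with h | h
      · have : j = kk := Fin.ext h.symm
        rw [this, h3]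
      · exact h1 j h
    · rintro ⟨h1, h2⟩
      exact ⟨⟨fun j hj => h1 j (by omega), h2⟩, h1 kk le_rfl⟩
  rw [e1]
  have e2 : ∑ w ∈ (HK n k).filter (fun w : Om n => ¬ w.1 kk = kk),
      altM b ((Finset.range k).val.map (lb lab w)) = 0 := by
    apply Finset.sum_involution (fun (w : Om n) _ => (w.1, Function.update w.2 (w.1 kk) (!(w.2 (w.1 kk)))))
    · intro w hw
      have : (Finset.range k).val.map (lb lab (w.1, Function.update w.2 (w.1 kk) (!(w.2 (w.1 kk)))))
        = (Finset.range k).val.map (lb lab w) := by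
        apply Multiset.map_congr rfl
        intro i' hi'
        have hne : i' < k := by simpa using hi'
        have : xv (w.1, Function.update w.2 (w.1 kk) (!(w.2 (w.1 kk)))) i' = xv w i' := by
          funext j
          by_cases hj : j = w.1 kk
          · subst hj
            simp [xv, kk, not_le.2 hne]
          · simp [xv, Function.update_of_ne hj]
        simp only [lb, this]
      rw [this]
      exact zz _
    · intro w hw _ h
      have h1 := congrFun (congrArg Prod.snd h) (w.1 kk)
      simp at h1
    · intro w hw
      simp only [HK, Finset.mem_filter, Finset.mem_univ, true_and] at hw ⊢
      refine ⟨⟨hw.1.1, fun j hj => ?_⟩, hw.2⟩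
      have : j ≠ w.1 kk := by
        rintro rfl
        rcases hj.eq_or_lt with h | h
        · exact hw.2 (Fin.ext h.symm)
        · have := hw.1.1 _ h
          exact hw.2 (w.1.injective this)
      simp only [Function.update_of_ne this]
      exact hw.1.2 j hj
    · intro w hw
      simp
  rw [e2, add_zero]

lemma step_sum {n k : ℕ} (hk : k + 1 ≤ n)
    (lab : (Fin n → SignType) → ℕ × Bool)
    (hneg : ∀ x, x ≠ 0 → lab (-x) = ((lab x).1, !(lab x).2))
    (hcomp : ∀ x y, x ≠ 0 → (∀ j, x j ≠ 0 → y j = x j) → (lab x).1 = (lab y).1 → (lab x).2 = (lab y).2)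
    (b : Bool) :
    ∑ w ∈ OmK n (k + 1), altM b ((Finset.range (k + 1)).val.map (lb lab w)) =
    ∑ w ∈ OmK n k, altM b ((Finset.range k).val.map (lb lab w)) := by
  classical
  have hn : 0 < n := by omega
  set kk : Fin n := ⟨k, by omega⟩
  -- boundary
  have h1 : ∑ w ∈ HK n k, (altM b ((Finset.range (k + 1)).val.map (lb lab w)) +
      altM (!b) ((Finset.range (k + 1)).val.map (lb lab w))) =
      ∑ w ∈ OmK n k, altM b ((Finset.range k).val.map (lb lab w)) := by
    rw [← last_face hk lab b]
    have : ∀ w ∈ HK n k, altM b ((Finset.range (k + 1)).val.map (lb lab w)) +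
      altM (!b) ((Finset.range (k + 1)).val.map (lb lab w)) =
      ∑ i ∈ Finset.range (k + 1), altM b (((Finset.range (k + 1)).erase i).val.map (lb lab w)) := by
      intro w _
      rw [← altM_sum, Multiset.map_map, Finset.sum]
      congr 1
      apply Multiset.map_congr rfl
      intro i hi
      simp only [Function.comp]
      rw [Finset.erase_val, Multiset.map_erase_of_mem _ _ hi]
    rw [Finset.sum_congr rfl this, Finset.sum_comm, Finset.sum_range_succ, Finset.sum_eq_zero, zero_add]
    intro i hi
    exact swap_cancel hk (by simpa using hi) lab b
  rw [← h1, ← Finset.sum_filter_add_sum_filter_not _ (fun w : Om n => w.2 kk = true), Finset.sum_add_distrib]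
  have e1 : (OmK n (k + 1)).filter (fun w : Om n => w.2 kk = true) = HK n k := by
    ext w
    simp only [HK, OmK, Finset.mem_filter, Finset.mem_univ, true_and]
    constructor
    · rintro ⟨⟨h1, h2⟩, h3⟩
      refine ⟨h1, fun j hj => ?_⟩
      rcases hj.eq_or_lt with h | h
      · have : j = kk := Fin.ext h.symm
        rw [this, h3]
      · exact h2 j h
    · rintro ⟨h1, h2⟩
      exact ⟨⟨h1, fun j hj => h2 j (by omega)⟩, h2 kk le_rfl⟩
  rw [e1]
  congr 1
  let fl : Om n → Om n := fun w => (w.1, fun j => if j.val ≤ k then !(w.2 j) else w.2 j)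
  have flfl : ∀ w, fl (fl w) = w := by
    intro w
    apply Prod.ext
    · rfl
    · funext j
      by_cases h : j.val ≤ k <;> simp [fl, h]
  apply Finset.sum_bij' (fun w _ => fl w) (fun w _ => fl w)
  · intro w hw
    simp only [HK, OmK, Finset.mem_filter, Finset.mem_univ, true_and] at hw ⊢
    refine ⟨hw.1.1, fun j hj => ?_⟩
    rcases hj.eq_or_lt with h | h
    · have : j = kk := Fin.ext h.symm
      subst this
      have := hw.2
      simp [fl, kk] at this ⊢
      exact this
    · simp only [fl, if_neg (not_le.2 h)]
      exact hw.1.2 j h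
  · intro w hw
    simp only [HK, OmK, Finset.mem_filter, Finset.mem_univ, true_and] at hw ⊢
    refine ⟨⟨hw.1, fun j hj => ?_⟩, ?_⟩
    · simp only [fl, if_neg (not_le.2 (show k < j.val by omega))]
      exact hw.2 j (by omega)
    · have := hw.2 kk le_rfl
      simp [fl, kk] at this ⊢
      exact this
  · intro w _; exact flfl w
  · intro w _; exact flfl w
  · intro w hw
    simp only [OmK, Finset.mem_filter, Finset.mem_univ, true_and] at hw
    have : (Finset.range (k + 1)).val.map (lb lab (fl w)) =
        ((Finset.range (k + 1)).val.map (lb lab w)).map negL := by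
      rw [Multiset.map_map]
      apply Multiset.map_congr rfl
      intro i hi
      have hi' : i < k + 1 := Finset.mem_range.1 hi
      have : xv (fl w) i = - xv w i := by
        funext j
        by_cases hj : (w.1.symm j).val ≤ i
        · have : j.val ≤ k := by
            by_contra hh
            have h2 := hw.1.1 j (by omega)
            have h3 : w.1.symm j = j := by rw [Equiv.symm_apply_eq, h2]
            rw [h3] at hj; omega
          cases hb : w.2 j <;> simp [xv, fl, hj, this, hb]
        · simp [xv, fl, hj]
      simp only [lb, Function.comp, this, hneg _ (xv_ne hn w i), negL, ofLex_toLex]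
    rw [this, altM_neg _ _ (noComp_lb hn lab hcomp w _), Bool.not_not]

lemma tucker {n : ℕ} (M : ℕ) (lab : (Fin n → SignType) → ℕ × Bool)
    (hM : ∀ x, x ≠ 0 → (lab x).1 < M)
    (hneg : ∀ x, x ≠ 0 → lab (-x) = ((lab x).1, !(lab x).2))
    (hcomp : ∀ x y, x ≠ 0 → (∀ j, x j ≠ 0 → y j = x j) → (lab x).1 = (lab y).1 → (lab x).2 = (lab y).2) :
    n ≤ M := by
  classical
  rcases Nat.eq_zero_or_pos n with h0 | hn
  · omega
  have key : ∀ k, k ≤ n → ∑ w ∈ OmK n k, altM true ((Finset.range k).val.map (lb lab w)) = 1 := by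
    intro k
    induction k with
    | zero =>
      intro _
      have : OmK n 0 = {((1 : Equiv.Perm (Fin n)), fun _ => true)} := by
        ext w
        simp only [OmK, Finset.mem_filter, Finset.mem_univ, true_and, Finset.mem_singleton]
        constructor
        · rintro ⟨h1, h2⟩
          apply Prod.ext
          · ext j; simp [h1 j]
          · funext j; simp [h2 j]
        · rintro rfl; simp
      rw [this, Finset.sum_singleton]
      simp [altM, altI, AltL]
    | succ k ih =>
      intro hk
      rw [step_sum hk lab hneg hcomp, ih (by omega)]
  have h1 := key n le_rfl
  obtain ⟨w, _, hw⟩ := Finset.exists_ne_zero_of_sum_ne_zero (by rw [h1]; exact one_ne_zero)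
  have := altM_card true _ (noComp_lb hn lab hcomp w _) M (by
    intro a ha
    rw [Multiset.mem_map] at ha
    obtain ⟨i, _, rfl⟩ := ha
    exact hM _ (xv_ne hn w i)) hw
  simpa using this

lemma tuckerQ {n : ℕ} (M : ℕ) (Q : (Fin n → SignType) → Bool → ℕ → Prop)
    (hM : ∀ x s j, Q x s j → j < M)
    (hex : ∀ x, x ≠ 0 → ∃ s, Q x s 0)
    (hmono : ∀ x y, (∀ j, x j ≠ 0 → y j = x j) → ∀ s j, Q x s j → Q y s j)
    (hneg : ∀ x s j, Q x s j → Q (-x) (!s) j)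
    (hdbl : ∀ x j, Q x true j → Q x false j → ∃ s j', j < j' ∧ Q x s j') : n ≤ M := by
  classical
  have hg : ∀ x : Fin n → SignType, ∃ l : ℕ × Bool, x ≠ 0 →
      (Q x l.2 l.1 ∧ ∀ s j, Q x s j → j ≤ l.1) := by
    intro x
    by_cases hx : x = 0
    · exact ⟨(0, true), fun h => absurd hx h⟩
    obtain ⟨s0, hs0⟩ := hex x hx
    have hP : ∃ j, ∃ s, Q x s j := ⟨0, s0, hs0⟩
    have := Nat.findGreatest_spec (P := fun j => ∃ s, Q x s j) (m := 0) (n := M) (Nat.zero_le _) ⟨s0, hs0⟩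
    obtain ⟨s, hs⟩ := this
    refine ⟨(_, s), fun _ => ⟨hs, fun s' j hj => ?_⟩⟩
    exact Nat.le_findGreatest (hM _ _ _ hj).le ⟨s', hj⟩
  choose lab hlab using hg
  have huniq : ∀ x, x ≠ 0 → ∀ s, Q x s (lab x).1 → s = (lab x).2 := by
    intro x hx s hs
    by_contra hne
    obtain ⟨h1, h2⟩ := hlab x hx
    have : ∃ s j', (lab x).1 < j' ∧ Q x s j' := by
      apply hdbl x
      · cases s
        · have : (lab x).2 = true := by cases h : (lab x).2 <;> simp_all
          rwa [this] at h1
        · exact hs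
      · cases s
        · exact hs
        · have : (lab x).2 = false := by cases h : (lab x).2 <;> simp_all
          rwa [this] at h1
    obtain ⟨s', j', h3, h4⟩ := this
    have := h2 s' j' h4
    omega
  refine tucker M lab (fun x hx => hM _ _ _ (hlab x hx).1) ?_ ?_
  · intro x hx
    have hx' : -x ≠ 0 := by
      intro h; apply hx; funext j
      have := congrFun h j
      simpa using this
    obtain ⟨h1, h2⟩ := hlab x hx
    obtain ⟨h3, h4⟩ := hlab _ hx'
    have e : (lab (-x)).1 = (lab x).1 := by
      apply le_antisymm
      · have := hneg _ _ _ h3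
        rw [show - -x = x by funext j; simp] at this
        exact h2 _ _ this
      · exact h4 _ _ (hneg _ _ _ h1)
    refine Prod.ext e ?_
    have := hneg _ _ _ h1
    rw [← e] at this
    exact (huniq _ hx' _ this).symm
  · intro x y hx hxy h
    have hy : y ≠ 0 := by
      intro hy; apply hx; funext j
      by_contra hj
      have := hxy j hj
      rw [hy] at this
      exact hj this.symm
    have h1 := hmono x y hxy _ _ (hlab x hx).1
    rw [h] at h1
    exact huniq y hy _ h1


def sv : Bool → ℕ → SignType
  | s, 0 => if s then 1 else -1
  | s, a + 1 => sv (!s) a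

lemma sv_neg : ∀ (a : ℕ) (s : Bool), - sv s a = sv (!s) a := by
  intro a
  induction a with
  | zero => intro s; cases s <;> simp [sv]
  | succ a ih => intro s; simp only [sv]; exact ih _

lemma sv_even : ∀ (a : ℕ) (s : Bool), sv s (2 * a) = sv s 0 := by
  intro a
  induction a with
  | zero => intro s; rfl
  | succ a ih =>
    intro s
    rw [show 2 * (a + 1) = 2 * a + 1 + 1 by ring]
    simp only [sv, Bool.not_not] at ih ⊢
    exact ih s

lemma sv_ne (s : Bool) (a : ℕ) : sv s a ≠ 0 := by
  induction a generalizing s with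
  | zero => cases s <;> simp [sv]
  | succ a ih => exact ih _

def Has {n : ℕ} (x : Fin n → SignType) (s : Bool) (j : ℕ) : Prop :=
  ∃ f : ℕ → Fin n, (∀ a b, a < b → b < j → f a < f b) ∧ ∀ a, a < j → x (f a) = sv s a

lemma Has.cons {n : ℕ} {x : Fin n → SignType} {s : Bool} {j : ℕ} (i : Fin n)
    (hi : x i = sv (!s) 0) (f : ℕ → Fin n) (h1 : ∀ a b, a < b → b < j → f a < f b)
    (h2 : ∀ a, a < j → x (f a) = sv s a) (h3 : i < f 0) : Has x (!s) (j + 1) := by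
  refine ⟨fun a => Nat.casesOn a i f, ?_, ?_⟩
  · intro a b hab hb
    cases b with
    | zero => omega
    | succ b =>
      cases a with
      | zero =>
        rcases Nat.eq_zero_or_pos b with h | h
        · subst h; exact h3
        · exact h3.trans (h1 0 b h (by omega))
      | succ a => exact h1 a b (by omega) (by omega)
  · intro a ha
    cases a with
    | zero => exact hi
    | succ a => simp only [sv, Bool.not_not]; exact h2 a (by omega)

lemma Has.double {n : ℕ} {x : Fin n → SignType} {j : ℕ} (h1 : Has x true (j + 1))
    (h2 : Has x false (j + 1)) : ∃ s, Has x s (j + 2) := by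
  obtain ⟨f, f1, f2⟩ := h1
  obtain ⟨g, g1, g2⟩ := h2
  rcases lt_trichotomy (f 0) (g 0) with h | h | h
  · exact ⟨_, Has.cons (s := false) (f 0) (f2 0 (by omega)) g g1 g2 h⟩
  · have a1 := f2 0 (by omega)
    have a2 := g2 0 (by omega)
    rw [h, a2] at a1
    simp [sv] at a1
  · exact ⟨_, Has.cons (s := true) (g 0) (g2 0 (by omega)) f f1 f2 h⟩

def Stab {n : ℕ} (r : ℕ) (S : Finset (Fin n)) : Prop :=
  S.card = r ∧ ∀ i ∈ S, ∀ j ∈ S, i.val + 1 ≠ j.val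

lemma Has.stab {n r : ℕ} {x : Fin n → SignType} {s : Bool} (h : Has x s (2 * r)) :
    ∃ S : Finset (Fin n), Stab r S ∧ ∀ i ∈ S, x i = sv s 0 := by
  obtain ⟨f, f1, f2⟩ := h
  refine ⟨(Finset.range r).image (fun a => f (2 * a)), ⟨?_, ?_⟩, ?_⟩
  · rw [Finset.card_image_of_injOn, Finset.card_range]
    intro a ha b hb hab
    simp only [Finset.coe_range, Set.mem_Iio] at ha hb
    simp only at hab
    by_contra hne
    rcases Nat.lt_or_gt_of_ne hne with h | h
    · exact absurd hab (f1 (2 * a) (2 * b) (by omega) (by omega)).ne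
    · exact absurd hab (f1 (2 * b) (2 * a) (by omega) (by omega)).ne'
  · intro i hi j hj hij
    simp only [Finset.mem_image, Finset.mem_range] at hi hj
    obtain ⟨a, ha, rfl⟩ := hi
    obtain ⟨b, hb, rfl⟩ := hj
    have hab : a < b := by
      by_contra hh
      rcases (not_lt.1 hh).eq_or_lt with h | h
      · subst h; omega
      · have := f1 (2 * b) (2 * a) (by omega) (by omega)
        rw [Fin.lt_def] at this; omega
    have h1 := f1 (2 * a) (2 * a + 1) (by omega) (by omega)
    have h2 := f1 (2 * a + 1) (2 * b) (by omega) (by omega)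
    rw [Fin.lt_def] at h1 h2
    omega
  · intro i hi
    simp only [Finset.mem_image, Finset.mem_range] at hi
    obtain ⟨a, ha, rfl⟩ := hi
    rw [f2 _ (by omega), sv_even]

lemma schrijver {n r C : ℕ} (hr : 1 ≤ r) (c : Finset (Fin n) → ℕ)
    (hC : ∀ S, Stab r S → c S < C)
    (hc : ∀ S T, Stab r S → Stab r T → Disjoint S T → c S ≠ c T) : n ≤ 2 * r - 1 + C := by
  classical
  let Q : (Fin n → SignType) → Bool → ℕ → Prop := fun x s j =>
    if j < 2 * r - 1 then Has x s (j + 1) else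
      ∃ S, Stab r S ∧ (∀ i ∈ S, x i = sv s 0) ∧ j = 2 * r - 1 + c S
  have Q1 : ∀ x s j, j < 2 * r - 1 → (Q x s j ↔ Has x s (j + 1)) := by
    intro x s j h; simp only [Q, if_pos h]
  have Q2 : ∀ x s j, ¬ j < 2 * r - 1 → (Q x s j ↔
      ∃ S, Stab r S ∧ (∀ i ∈ S, x i = sv s 0) ∧ j = 2 * r - 1 + c S) := by
    intro x s j h; simp only [Q, if_neg h]
  apply tuckerQ (2 * r - 1 + C) Q
  · intro x s j h
    by_cases hj : j < 2 * r - 1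
    · omega
    · rw [Q2 _ _ _ hj] at h
      obtain ⟨S, h1, _, h2⟩ := h
      have := hC S h1
      omega
  · intro x hx
    have : ∃ i, x i ≠ 0 := by
      by_contra hh; push Not at hh; exact hx (funext hh)
    obtain ⟨i, hi⟩ := this
    have : ∃ s, x i = sv s 0 := by
      generalize x i = z at hi
      cases z
      · exact absurd rfl hi
      · exact ⟨false, rfl⟩
      · exact ⟨true, rfl⟩
    obtain ⟨s, hs⟩ := this
    refine ⟨s, (Q1 _ _ _ (by omega)).2 ⟨fun _ => i, ?_, ?_⟩⟩
    · intro a b h1 h2; omega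
    · intro a ha
      have : a = 0 := by omega
      subst this; exact hs
  · intro x y hxy s j h
    by_cases hj : j < 2 * r - 1
    · rw [Q1 _ _ _ hj] at h ⊢
      obtain ⟨f, f1, f2⟩ := h
      refine ⟨f, f1, fun a ha => ?_⟩
      rw [← f2 a ha]
      apply hxy
      rw [f2 a ha]; exact sv_ne _ _
    · rw [Q2 _ _ _ hj] at h ⊢
      obtain ⟨S, h1, h2, h3⟩ := h
      refine ⟨S, h1, fun i hi => ?_, h3⟩
      rw [← h2 i hi]
      apply hxy
      rw [h2 i hi]; exact sv_ne _ _
  · intro x s j h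
    by_cases hj : j < 2 * r - 1
    · rw [Q1 _ _ _ hj] at h ⊢
      obtain ⟨f, f1, f2⟩ := h
      refine ⟨f, f1, fun a ha => ?_⟩
      rw [Pi.neg_apply, f2 a ha, sv_neg]
    · rw [Q2 _ _ _ hj] at h ⊢
      obtain ⟨S, h1, h2, h3⟩ := h
      refine ⟨S, h1, fun i hi => ?_, h3⟩
      rw [Pi.neg_apply, h2 i hi, sv_neg]
  · intro x j h1 h2
    by_cases hj : j < 2 * r - 1
    · rw [Q1 _ _ _ hj] at h1 h2
      obtain ⟨s, hs⟩ := Has.double h1 h2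
      by_cases hj' : j + 1 < 2 * r - 1
      · exact ⟨s, j + 1, by omega, (Q1 _ _ _ hj').2 hs⟩
      · have e : j + 2 = 2 * r := by omega
        rw [e] at hs
        obtain ⟨S, hS, hS2⟩ := hs.stab
        exact ⟨s, 2 * r - 1 + c S, by omega, (Q2 _ _ _ (by omega)).2 ⟨S, hS, hS2, rfl⟩⟩
    · exfalso
      rw [Q2 _ _ _ hj] at h1 h2
      obtain ⟨S, a1, a2, a3⟩ := h1
      obtain ⟨T, b1, b2, b3⟩ := h2
      refine hc S T a1 b1 ?_ (by omega)
      rw [Finset.disjoint_left]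
      intro i hi hi'
      have := (a2 i hi).symm.trans (b2 i hi')
      simp [sv] at this

lemma card_small (n t : ℕ) :
    ((Finset.univ : Finset (Finset (Fin n))).filter (fun T => T.card ≤ t)).card ≤ (n + 1) ^ t := by
  classical
  let g : (Fin t → Option (Fin n)) → Finset (Fin n) :=
    fun f => Finset.univ.filter (fun a => ∃ i, f i = some a)
  calc _ ≤ ((Finset.univ : Finset (Fin t → Option (Fin n))).image g).card := by
        apply Finset.card_le_card
        intro T hT
        simp only [Finset.mem_filter, Finset.mem_univ, true_and] at hT
        simp only [Finset.mem_image, Finset.mem_univ, true_and]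
        refine ⟨fun i => T.toList[i.val]?, ?_⟩
        ext a
        simp only [g, Finset.mem_filter, Finset.mem_univ, true_and]
        constructor
        · rintro ⟨i, hi⟩
          exact Finset.mem_toList.1 (List.mem_of_getElem? hi)
        · intro ha
          obtain ⟨i, hi, hi'⟩ := List.mem_iff_getElem.1 (Finset.mem_toList.2 ha)
          have : i < t := by rw [Finset.length_toList] at hi; omega
          exact ⟨⟨i, this⟩, by simp only; rw [List.getElem?_eq_getElem hi, hi']⟩
    _ ≤ (Finset.univ : Finset (Fin t → Option (Fin n))).card := Finset.card_image_le
    _ = (n + 1) ^ t := by simp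

open Classical in
noncomputable def starI {n : ℕ} (S : Finset (Fin n)) : Finset (Fin n) :=
  Finset.univ.filter (fun i => i ∉ S ∧ ∀ j ∈ S, j.val ≠ i.val + 1)

lemma starI_card {n r : ℕ} (S : Finset (Fin n)) (hS : Stab r S) :
    (starI S).card + 2 * r ≤ n + 1 := by
  classical
  let P := (S.filter (fun j => j.val ≠ 0)).image (fun j : Fin n => (⟨j.val - 1, by omega⟩ : Fin n))
  have hP : r ≤ P.card + 1 := by
    have h1 : P.card = (S.filter (fun j => j.val ≠ 0)).card := by
      apply Finset.card_image_of_injOn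
      intro a ha b hb hab
      simp only [Finset.coe_filter, Set.mem_ofPred_eq] at ha hb
      simp only [Fin.mk.injEq] at hab
      apply Fin.ext; omega
    have h2 := Finset.card_filter_add_card_filter_not (s := S) (fun j => j.val ≠ 0)
    have h3 : (S.filter (fun j => ¬ j.val ≠ 0)).card ≤ 1 := by
      apply Finset.card_le_one.2
      intro a ha b hb
      simp only [Finset.mem_filter, not_not] at ha hb
      apply Fin.ext; omega
    rw [hS.1] at h2
    omega
  have memP : ∀ i, i ∈ P → ∃ j ∈ S, j.val = i.val + 1 := by
    intro i hi
    simp only [P, Finset.mem_image, Finset.mem_filter] at hi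
    obtain ⟨j, ⟨h1, h2⟩, rfl⟩ := hi
    exact ⟨j, h1, by simp only; omega⟩
  have d1 : Disjoint S P := by
    rw [Finset.disjoint_left]
    intro i hi hp
    obtain ⟨j, hj, e⟩ := memP i hp
    exact hS.2 i hi j hj e.symm
  have d2 : Disjoint (S ∪ P) (starI S) := by
    rw [Finset.disjoint_left]
    intro i hi hI
    simp only [starI, Finset.mem_filter, Finset.mem_univ, true_and] at hI
    rcases Finset.mem_union.1 hi with h | h
    · exact hI.1 h
    · obtain ⟨j, hj, e⟩ := memP i h
      exact hI.2 j hj e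
  have := Finset.card_le_univ ((S ∪ P) ∪ starI S)
  rw [Finset.card_union_of_disjoint d2, Finset.card_union_of_disjoint d1, hS.1, Fintype.card_fin] at this
  omega

lemma prop_aux {a b c d : Prop} (s1 : a → ¬ b) (s2 : c → ¬ d) (hm : (¬ a ∧ ¬ b) ↔ (¬ c ∧ ¬ d))
    (ih : a ↔ c) : b ↔ d := by
  by_cases a <;> by_cases b <;> by_cases c <;> by_cases d <;> simp_all

lemma starI_inj {n : ℕ} {r : ℕ} (S T : Finset (Fin n)) (hS : Stab r S) (hT : Stab r T)
    (h : starI S = starI T)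
    (h0 : (∃ j ∈ S, j.val = 0) ↔ (∃ j ∈ T, j.val = 0)) : S = T := by
  have key : ∀ i : ℕ, ((∃ j ∈ S, j.val = i) ↔ (∃ j ∈ T, j.val = i)) := by
    intro i
    induction i with
    | zero => exact h0
    | succ i ih =>
      by_cases hi : i < n
      · have hm : (⟨i, hi⟩ : Fin n) ∈ starI S ↔ (⟨i, hi⟩ : Fin n) ∈ starI T := by rw [h]
        simp only [starI, Finset.mem_filter, Finset.mem_univ, true_and] at hm
        have e : ∀ U : Finset (Fin n), (⟨i, hi⟩ : Fin n) ∈ U ↔ ∃ j ∈ U, j.val = i := by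
          intro U
          constructor
          · intro hU; exact ⟨_, hU, rfl⟩
          · rintro ⟨j, hj, rfl⟩; exact hj
        have sS : ∀ U : Finset (Fin n), Stab r U → (∃ j ∈ U, j.val = i) → ¬ ∃ j ∈ U, j.val = i + 1 := by
          rintro U hU ⟨j, hj, rfl⟩ ⟨j', hj', e'⟩
          exact hU.2 j hj j' hj' e'.symm
        have s1 := sS S hS
        have s2 := sS T hT
        rw [e, e] at hm
        have e3 : ∀ U : Finset (Fin n), (∀ j ∈ U, j.val ≠ i + 1) ↔ ¬ ∃ j ∈ U, j.val = i + 1 := by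
          intro U; push Not; rfl
        rw [e3, e3] at hm
        exact prop_aux s1 s2 hm ih
      · constructor
        · rintro ⟨j, _, e⟩; omega
        · rintro ⟨j, _, e⟩; omega
  ext j
  have := key j.val
  constructor
  · intro hj
    obtain ⟨j', h1, h2⟩ := this.1 ⟨j, hj, rfl⟩
    rwa [← Fin.ext h2]
  · intro hj
    obtain ⟨j', h1, h2⟩ := this.2 ⟨j, hj, rfl⟩
    rwa [← Fin.ext h2]

lemma graph_ex (χ r n : ℕ) (hr : 1 ≤ r) (hn : n + 1 = 2 * r + χ) :
    ∃ (v : ℕ) (adj : Fin v → Fin v → Prop) (I : Fin v → Finset (Fin n)) (col : Fin n → Fin v → Bool),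
      (∀ p q, adj p q → adj q p) ∧ (∀ p, ¬ adj p p) ∧ (∀ p, (I p).card ≤ χ) ∧
      (∀ i p q, adj p q → i ∉ I p → i ∉ I q → col i p ≠ col i q) ∧
      (∀ (C : ℕ) (c : Fin v → Fin C), (∀ p q, adj p q → c p ≠ c q) → χ ≤ C) ∧
      v ≤ 2 * (n + 1) ^ χ := by
  classical
  let V := {S : Finset (Fin n) // Stab r S}
  let e : V ≃ Fin (Fintype.card V) := Fintype.equivFin V
  refine ⟨Fintype.card V, fun p q => Disjoint (e.symm p).1 (e.symm q).1, fun p => starI (e.symm p).1,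
    fun i p => decide (i ∈ (e.symm p).1), ?_, ?_, ?_, ?_, ?_, ?_⟩
  · intro p q h; exact h.symm
  · intro p h
    have h1 := (e.symm p).2.1
    rw [disjoint_self] at h
    rw [h] at h1
    simp at h1; omega
  · intro p
    change (starI (e.symm p).1).card ≤ χ
    have := starI_card _ (e.symm p).2
    omega
  · intro i p q h h1 h2 h3
    rw [Finset.disjoint_left] at h
    simp only [starI, Finset.mem_filter, Finset.mem_univ, true_and, not_and] at h1 h2
    by_cases hi : i ∈ (e.symm p).1
    · have : i ∈ (e.symm q).1 := by simpa [hi] using h3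
      exact h hi this
    · have hi' : i ∉ (e.symm q).1 := by simpa [hi] using h3
      have a1 := h1 hi
      have a2 := h2 hi'
      push Not at a1 a2
      obtain ⟨j, hj, ej⟩ := a1
      obtain ⟨j', hj', ej'⟩ := a2
      have : j = j' := Fin.ext (ej.trans ej'.symm)
      subst this
      exact h hj hj'
  · intro C c hc
    let c' : Finset (Fin n) → ℕ := fun S => if h : Stab r S then (c (e ⟨S, h⟩)).val else 0
    have := schrijver (n := n) (r := r) (C := C) hr c' (by
      intro S hS
      simp only [c', dif_pos hS]
      exact (c _).2) (by
      intro S T hS hT hd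
      simp only [c', dif_pos hS, dif_pos hT]
      intro h
      refine hc (e ⟨S, hS⟩) (e ⟨T, hT⟩) ?_ (Fin.ext h)
      simpa using hd)
    omega
  · let F := ((Finset.univ : Finset (Finset (Fin n))).filter (fun T => T.card ≤ χ))
    have hF := card_small n χ
    let g : V → Finset (Fin n) × Bool := fun S => (starI S.1, decide (∃ j ∈ S.1, j.val = 0))
    have : (Finset.univ : Finset V).card ≤ (F ×ˢ (Finset.univ : Finset Bool)).card := by
      apply Finset.card_le_card_of_injOn g
      · intro S _
        simp only [F, g, Finset.coe_product, Set.mem_prod, Finset.coe_filter, Set.mem_ofPred_eq,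
          Finset.mem_univ, true_and, Finset.coe_univ, Set.mem_univ, and_true]
        have := starI_card _ S.2
        omega
      · intro S _ T _ hST
        simp only [g, Prod.mk.injEq, decide_eq_decide] at hST
        exact Subtype.ext (starI_inj _ _ S.2 T.2 hST.1 hST.2)
    rw [Finset.card_product, Finset.card_univ, Finset.card_univ, Fintype.card_bool] at this
    calc _ ≤ F.card * 2 := this
      _ ≤ _ := by rw [mul_comm]; exact Nat.mul_le_mul_left 2 hF


open Classical in
noncomputable def badM (n : ℕ) (J : Finset (Fin n)) : Finset (Fin n → Fin n → Bool) :=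
  Finset.univ.filter (fun R => ∀ i, ∃ j ∈ J, R i j = false)

lemma badM_card (n q : ℕ) (J : Finset (Fin n)) (hJ : J.card ≤ q) :
    (badM n J).card ≤ (2 ^ n - 2 ^ (n - q)) ^ n := by
  classical
  let br : Finset (Fin n → Bool) := Finset.univ.filter (fun x => ∃ j ∈ J, x j = false)
  have e : badM n J = Fintype.piFinset (fun _ : Fin n => br) := by
    ext R; simp [badM, br, Fintype.mem_piFinset]
  rw [e, Fintype.card_piFinset, Finset.prod_const, Finset.card_univ, Fintype.card_fin]
  apply Nat.pow_le_pow_left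
  have h2 := Finset.card_filter_add_card_filter_not (s := (Finset.univ : Finset (Fin n → Bool)))
    (fun x => ∃ j ∈ J, x j = false)
  have h3 : (Finset.univ : Finset (Fin n → Bool)).filter (fun x => ¬ ∃ j ∈ J, x j = false) =
      Fintype.piFinset (fun j : Fin n => if j ∈ J then {true} else Finset.univ) := by
    ext x
    simp only [Finset.mem_filter, Finset.mem_univ, true_and, Fintype.mem_piFinset]
    constructor
    · intro h j
      split_ifs with hj
      · push Not at h
        simpa using h j hj
      · simp
    · rintro h ⟨j, hj, hx⟩
      have := h j
      rw [if_pos hj, hx] at this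
      simp at this
  have h4 : (Fintype.piFinset (fun j : Fin n => if j ∈ J then ({true} : Finset Bool) else Finset.univ)).card
      = 2 ^ (n - J.card) := by
    rw [Fintype.card_piFinset]
    have : ∀ j : Fin n, (if j ∈ J then ({true} : Finset Bool) else Finset.univ).card
        = if j ∈ J then 1 else 2 := by
      intro j; split_ifs <;> simp
    simp only [this]
    rw [Finset.prod_ite]
    simp only [Finset.prod_const, one_pow, one_mul]
    congr 1
    rw [← Finset.compl_filter, Finset.card_compl, Fintype.card_fin]
    congr 2
    ext; simp
  rw [h3, h4] at h2
  have h5 : (2 : ℕ) ^ (n - q) ≤ 2 ^ (n - J.card) := Nat.pow_le_pow_right (by norm_num) (by omega)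
  have h6 : (Finset.univ : Finset (Fin n → Bool)).card = 2 ^ n := by simp
  rw [h6] at h2
  change (Finset.univ.filter (fun x : Fin n → Bool => ∃ j ∈ J, x j = false)).card ≤ _
  omega

lemma matrix_ex (n q : ℕ) (h : 2 * (n + 1) ^ q * (2 ^ n - 2 ^ (n - q)) ^ n < (2 ^ n) ^ n) :
    ∃ R : Fin n → Fin n → Bool,
      (∀ J : Finset (Fin n), J.card ≤ q → ∃ i, ∀ j ∈ J, R i j = true) ∧
      (∀ I : Finset (Fin n), I.card ≤ q → ∃ j, ∀ i ∈ I, R i j = false) := by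
  classical
  let F := ((Finset.univ : Finset (Finset (Fin n))).filter (fun T => T.card ≤ q))
  let B1 := F.biUnion (badM n)
  let φ : (Fin n → Fin n → Bool) → (Fin n → Fin n → Bool) := fun R i j => !(R j i)
  let B2 := B1.image φ
  have hB1 : B1.card ≤ (n + 1) ^ q * (2 ^ n - 2 ^ (n - q)) ^ n := by
    calc B1.card ≤ F.card * (2 ^ n - 2 ^ (n - q)) ^ n := by
          apply Finset.card_biUnion_le_card_mul
          intro J hJ
          exact badM_card n q J (by simpa [F] using hJ)
      _ ≤ _ := Nat.mul_le_mul_right _ (card_small n q)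
  have hB2 : B2.card ≤ B1.card := Finset.card_image_le
  have hlt : (B1 ∪ B2).card < (Finset.univ : Finset (Fin n → Fin n → Bool)).card := by
    have : (Finset.univ : Finset (Fin n → Fin n → Bool)).card = (2 ^ n) ^ n := by simp
    rw [this]
    refine lt_of_le_of_lt (Finset.card_union_le _ _) (lt_of_le_of_lt ?_ h)
    rw [mul_assoc]
    omega
  obtain ⟨R, _, hR⟩ := Finset.exists_mem_notMem_of_card_lt_card hlt
  rw [Finset.mem_union, not_or] at hR
  refine ⟨R, ?_, ?_⟩
  · intro J hJ
    by_contra hh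
    push Not at hh
    apply hR.1
    simp only [B1, F, Finset.mem_biUnion, Finset.mem_filter, Finset.mem_univ, true_and, badM]
    exact ⟨J, hJ, fun i => by obtain ⟨j, a, b⟩ := hh i; exact ⟨j, a, by simpa using b⟩⟩
  · intro I hI
    by_contra hh
    push Not at hh
    apply hR.2
    refine Finset.mem_image.2 ⟨φ R, ?_, ?_⟩
    · simp only [B1, F, Finset.mem_biUnion, Finset.mem_filter, Finset.mem_univ, true_and, badM]
      exact ⟨I, hI, fun i => by obtain ⟨j, a, b⟩ := hh i; exact ⟨j, a, by simpa [φ] using b⟩⟩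
    · funext i j; simp [φ]

lemma numeric (n q : ℕ) (hq : 1 ≤ q) (h1 : 2 ^ (16 * q) ≤ n) (h2 : n + 1 ≤ 2 ^ (17 * q)) :
    2 * (n + 1) ^ q * (2 ^ n - 2 ^ (n - q)) ^ n < (2 ^ n) ^ n := by
  have hq2 : q < 2 ^ q := Nat.lt_two_pow_self
  have hqn : q ≤ n := by
    have : 2 ^ q ≤ 2 ^ (16 * q) := Nat.pow_le_pow_right (by norm_num) (by omega)
    omega
  have key : (17 * q * q + 1 : ℝ) < (2 : ℝ) ^ (15 * q) := by
    have : 17 * q * q + 1 < 2 ^ (15 * q) := by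
      have e : 2 ^ (15 * q) = 2 ^ (13 * q) * (2 ^ q * 2 ^ q) := by
        rw [← pow_add, ← pow_add]; congr 1; ring
      have a : 2 ^ 13 ≤ 2 ^ (13 * q) := Nat.pow_le_pow_right (by norm_num) (by omega)
      have b : (q + 1) * (q + 1) ≤ 2 ^ q * 2 ^ q := Nat.mul_le_mul hq2 hq2
      rw [e]
      calc 17 * q * q + 1 < 2 ^ 13 * ((q + 1) * (q + 1)) := by nlinarith
        _ ≤ _ := Nat.mul_le_mul a b
    exact_mod_cast this
  have e2 : (2 : ℝ) ≤ Real.exp 1 := by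
    have := Real.add_one_le_exp (1 : ℝ); linarith
  have A : (2 * (n + 1) ^ q : ℝ) < Real.exp ((n : ℝ) / 2 ^ q) := by
    have hn : ((n : ℝ) + 1) ≤ 2 ^ (17 * q) := by exact_mod_cast h2
    calc (2 * (n + 1) ^ q : ℝ) ≤ 2 * (2 ^ (17 * q)) ^ q := by gcongr
      _ = 2 ^ (17 * q * q + 1) := by rw [← pow_mul, pow_succ]; ring
      _ ≤ (Real.exp 1) ^ (17 * q * q + 1) := by gcongr
      _ = Real.exp (17 * q * q + 1) := by rw [← Real.exp_nat_mul]; push_cast; ring_nf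
      _ < Real.exp (2 ^ (15 * q)) := Real.exp_lt_exp.2 key
      _ ≤ _ := by
        apply Real.exp_le_exp.2
        rw [le_div_iff₀ (by positivity), ← pow_add]
        rw [show 15 * q + q = 16 * q by ring]
        exact_mod_cast h1
  have B : (((2 ^ n - 2 ^ (n - q) : ℕ) : ℝ)) ^ n ≤ (2 ^ n) ^ n * Real.exp (-((n : ℝ) / 2 ^ q)) := by
    have : (((2 ^ n - 2 ^ (n - q) : ℕ) : ℝ)) ≤ 2 ^ n * Real.exp (-(1 / 2 ^ q)) := by
      rw [Nat.cast_sub (Nat.pow_le_pow_right (by norm_num) (by omega))]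
      push_cast
      have e : (2 : ℝ) ^ (n - q) = 2 ^ n * (1 / 2 ^ q) := by
        rw [pow_sub₀ _ (by norm_num) hqn]; simp
      rw [e]
      have := Real.add_one_le_exp (-(1 / 2 ^ q) : ℝ)
      calc (2 : ℝ) ^ n - 2 ^ n * (1 / 2 ^ q) = 2 ^ n * (-(1 / 2 ^ q) + 1) := by ring
        _ ≤ _ := by gcongr
    calc _ ≤ ((2 : ℝ) ^ n * Real.exp (-(1 / 2 ^ q))) ^ n := by gcongr
      _ = _ := by
        rw [mul_pow, ← Real.exp_nat_mul]
        congr 2; ring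
  have C : ((2 * (n + 1) ^ q * (2 ^ n - 2 ^ (n - q)) ^ n : ℕ) : ℝ) < (((2 ^ n) ^ n : ℕ) : ℝ) := by
    push_cast [-Nat.cast_sub]
    calc (2 * ((n : ℝ) + 1) ^ q * ((2 ^ n - 2 ^ (n - q) : ℕ) : ℝ) ^ n)
        ≤ (2 * ((n : ℝ) + 1) ^ q) * ((2 ^ n) ^ n * Real.exp (-((n : ℝ) / 2 ^ q))) := by gcongr
      _ < Real.exp ((n : ℝ) / 2 ^ q) * ((2 ^ n) ^ n * Real.exp (-((n : ℝ) / 2 ^ q))) := by gcongr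
      _ = (2 ^ n) ^ n * (Real.exp ((n : ℝ) / 2 ^ q) * Real.exp (-((n : ℝ) / 2 ^ q))) := by ring
      _ = _ := by rw [← Real.exp_add]; simp
  exact_mod_cast C


def ltp {s v : ℕ} (x y : Fin s × Fin v) : Prop := x.1 < y.1 ∨ (x.1 = y.1 ∧ x.2 < y.2)

lemma ltp_trans {s v : ℕ} {x y z : Fin s × Fin v} (h : ltp x y) (h' : ltp y z) : ltp x z := by
  unfold ltp at *; omega

lemma ltp_irrefl {s v : ℕ} (x : Fin s × Fin v) : ¬ ltp x x := by
  unfold ltp; omega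

lemma ltp_total {s v : ℕ} {x y : Fin s × Fin v} (h : x ≠ y) : ltp x y ∨ ltp y x := by
  unfold ltp
  by_contra hh
  apply h
  apply Prod.ext <;> omega

def inn {s v : ℕ} (adj : Fin v → Fin v → Prop) (x y : Fin s × Fin v) : Prop :=
  (ltp x y ∧ ¬ adj x.2 y.2) ∨ (ltp y x ∧ adj x.2 y.2)

lemma inn_irrefl {s v : ℕ} (adj : Fin v → Fin v → Prop) (x : Fin s × Fin v) : ¬ inn adj x x := by
  have := ltp_irrefl x
  unfold inn; tauto

lemma inn_total {s v : ℕ} (adj : Fin v → Fin v → Prop) (hs : ∀ p q, adj p q → adj q p)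
    (x y : Fin s × Fin v) (h : x ≠ y) : inn adj x y ↔ ¬ inn adj y x := by
  have h1 := ltp_total h
  have h2 : ¬ (ltp x y ∧ ltp y x) := fun h => ltp_irrefl x (ltp_trans h.1 h.2)
  have h3 : adj x.2 y.2 ↔ adj y.2 x.2 := ⟨hs _ _, hs _ _⟩
  unfold inn
  rw [h3]
  by_cases a : ltp x y <;> by_cases b : ltp y x <;> by_cases c : adj y.2 x.2 <;> simp_all

lemma chrom_upper {N s v : ℕ} {r : Fin N → Fin N → Prop} (e : Fin N → Bool × (Fin s × Fin v))
    (adj : Fin v → Fin v → Prop) (b : Bool) (U : Set (Fin N))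
    (hr : ∀ u w, (e u).1 = b → (e w).1 = b → (r u w ↔ inn adj (e u).2 (e w).2))
    (hU : ∀ u ∈ U, (e u).1 = b) (col : Fin v → Bool)
    (hcol : ∀ u ∈ U, ∀ w ∈ U, adj (e u).2.2 (e w).2.2 → col (e u).2.2 ≠ col (e w).2.2) :
    tournChromOn r U ≤ 2 := by
  apply Nat.sInf_le
  refine ⟨fun u => if col (e u).2.2 then 0 else 1, ?_⟩
  rintro i u ⟨hu, hu'⟩ w ⟨hw, hw'⟩ z ⟨hz, hz'⟩ h1 h2
  have key : ∀ a ∈ U, ∀ c ∈ U, (if col (e a).2.2 then (0 : Fin 2) else 1) = i →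
      (if col (e c).2.2 then (0 : Fin 2) else 1) = i → (r a c ↔ ltp (e a).2 (e c).2) := by
    intro a ha c hc ha' hc'
    rw [hr a c (hU a ha) (hU c hc)]
    have : ¬ adj (e a).2.2 (e c).2.2 := by
      intro hadj
      have h := hcol a ha c hc hadj
      rw [← hc'] at ha'
      cases h3 : col (e a).2.2 <;> cases h4 : col (e c).2.2 <;> simp_all
    simp [inn, this]
  rw [key u hu w hw hu' hw'] at h1
  rw [key w hw z hz hw' hz'] at h2
  rw [key u hu z hz hu' hz']
  exact ltp_trans h1 h2

lemma chrom_lower {N s v χ : ℕ} {r : Fin N → Fin N → Prop} (hirr : ∀ u, ¬ r u u)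
    (e : Fin N ≃ Bool × (Fin s × Fin v))
    (adj : Fin v → Fin v → Prop) (hs : ∀ p q, adj p q → adj q p) (hi : ∀ p, ¬ adj p p) (b : Bool)
    (hr : ∀ u w, (e u).1 = b → (e w).1 = b → (r u w ↔ inn adj (e u).2 (e w).2))
    (hchr : ∀ (C : ℕ) (c : Fin v → Fin C), (∀ p q, adj p q → c p ≠ c q) → χ ≤ C)
    (hsv : ∀ C, C < χ → C * v < s) :
    χ ≤ tournChromOn r {u | (e u).1 = b} := by
  classical
  apply le_csInf
  · refine ⟨N, id, ?_⟩
    rintro i u ⟨hu, hu'⟩ w ⟨hw, hw'⟩ z ⟨hz, hz'⟩ h1 h2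
    simp only [id] at hu' hw'
    rw [hu', hw'] at h1
    exact absurd h1 (hirr _)
  rintro C ⟨c, hc⟩
  by_contra hC
  push Not at hC
  let k : Fin s → Fin v → Fin C := fun i p => c (e.symm (b, (i, p)))
  -- bad copies
  let bad : Fin v → Finset (Fin s) := fun p => Finset.univ.filter (fun i => ∀ i', i < i' → k i' p ≠ k i p)
  have hbad : ∀ p, (bad p).card ≤ C := by
    intro p
    have : (bad p).card ≤ (Finset.univ : Finset (Fin C)).card := by
      apply Finset.card_le_card_of_injOn (fun i => k i p)
      · intro i _; simp
      · intro i hi i' hi' h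
        simp only [bad, Finset.coe_filter, Finset.mem_univ, true_and, Set.mem_ofPred_eq] at hi hi'
        simp only at h
        by_contra hne
        rcases lt_or_gt_of_ne hne with h1 | h1
        · exact hi i' h1 h.symm
        · exact hi' i h1 h
    simpa using this
  have hlt : ((Finset.univ : Finset (Fin v)).biUnion bad).card < (Finset.univ : Finset (Fin s)).card := by
    have : ((Finset.univ : Finset (Fin v)).biUnion bad).card ≤ (Finset.univ : Finset (Fin v)).card * C :=
      Finset.card_biUnion_le_card_mul _ _ _ (fun p _ => hbad p)
    have h2 := hsv C hC
    simp only [Finset.card_univ, Fintype.card_fin] at this ⊢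
    rw [mul_comm] at this
    omega
  obtain ⟨i0, _, hi0⟩ := Finset.exists_mem_notMem_of_card_lt_card hlt
  have hgood : ∀ p, ∃ i', i0 < i' ∧ k i' p = k i0 p := by
    intro p
    by_contra hh
    push Not at hh
    apply hi0
    simp only [Finset.mem_biUnion, Finset.mem_univ, true_and, bad, Finset.mem_filter]
    exact ⟨p, hh⟩
  have pat : ∀ p q (x y z : Fin s), adj p q → ltp (x, q) (y, p) → ltp (y, p) (z, q) →
      k x q = k y p → k y p = k z q → False := by
    intro p q x y z hadj h1 h2 e1 e2
    have t := hc (k y p) (e.symm (b, (z, q))) ⟨by simp, e2.symm⟩ (e.symm (b, (y, p))) ⟨by simp, rfl⟩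
      (e.symm (b, (x, q))) ⟨by simp, e1⟩
    rw [hr _ _ (by simp) (by simp), hr _ _ (by simp) (by simp), hr _ _ (by simp) (by simp)] at t
    simp only [Equiv.apply_symm_apply] at t
    have t' := t (Or.inr ⟨h2, hs _ _ hadj⟩) (Or.inr ⟨h1, hadj⟩)
    rcases t' with h | h
    · exact ltp_irrefl _ (ltp_trans h.1 (ltp_trans h1 h2))
    · exact hi _ h.2
  have := hchr C (k i0) (by
    intro p q hadj heq
    obtain ⟨i1, h1, e1⟩ := hgood p
    obtain ⟨i2, h2, e2⟩ := hgood q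
    have hne : (i1, p) ≠ (i2, q) := by
      intro h
      have : p = q := congrArg Prod.snd h
      rw [this] at hadj; exact hi _ hadj
    rcases ltp_total hne with h | h
    · exact pat p q i0 i1 i2 hadj (Or.inl h1) h (by rw [e1, heq]) (by rw [e1, e2, heq])
    · exact pat q p i0 i2 i1 (hs _ _ hadj) (Or.inl h2) h (by rw [e2, heq]) (by rw [e1, e2, heq]))
  omega

lemma size_bound (χ q n N k : ℕ) (hχ : 1 ≤ χ) (hq : 1 ≤ q) (hN0 : 1 ≤ N)
    (hn : n + 1 ≤ 2 ^ (17 * q)) (hN : N ≤ 8 * χ * (n + 1) ^ (2 * χ))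
    (hk : (k : ℝ) ≤ Real.log N / (32 * (χ : ℝ) ^ 2)) : k * χ ≤ q := by
  have hχ' : (1 : ℝ) ≤ χ := by exact_mod_cast hχ
  have hq' : (1 : ℝ) ≤ q := by exact_mod_cast hq
  have hN0' : (0 : ℝ) < N := by exact_mod_cast hN0
  have h1 : Real.log N ≤ Real.log (8 * (χ : ℝ) * ((n : ℝ) + 1) ^ (2 * χ)) :=
    Real.log_le_log hN0' (by exact_mod_cast hN)
  rw [Real.log_mul (by positivity) (by positivity), Real.log_pow] at h1
  have h2 : Real.log (8 * (χ : ℝ)) ≤ 8 * χ := by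
    have := Real.log_le_sub_one_of_pos (show (0 : ℝ) < 8 * χ by positivity)
    linarith
  have h3 : Real.log ((n : ℝ) + 1) ≤ 17 * q * Real.log 2 := by
    have : Real.log ((n : ℝ) + 1) ≤ Real.log ((2 : ℝ) ^ (17 * q)) :=
      Real.log_le_log (by positivity) (by exact_mod_cast hn)
    rw [Real.log_pow] at this
    push_cast at this
    exact this
  have h4 := Real.log_two_lt_d9
  have h5 : Real.log ((n : ℝ) + 1) ≤ 17 * q * 0.6932 := by
    refine h3.trans ?_
    gcongr
    linarith
  have h6 : Real.log N ≤ 8 * χ + 2 * χ * (17 * q * 0.6932) := by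
    push_cast at h1
    have : 2 * (χ : ℝ) * Real.log ((n : ℝ) + 1) ≤ 2 * χ * (17 * q * 0.6932) := by gcongr
    linarith
  rw [le_div_iff₀ (by positivity)] at hk
  have h7 : (k * χ : ℝ) * (32 * χ) ≤ q * (32 * χ) := by
    nlinarith
  have h8 : (k * χ : ℝ) ≤ q := le_of_mul_le_mul_right h7 (by positivity)
  exact_mod_cast h8

def crossRel {s v n : ℕ} (adj : Fin v → Fin v → Prop) (I : Fin v → Finset (Fin n))
    (R : Fin n → Fin n → Bool) : Bool × (Fin s × Fin v) → Bool × (Fin s × Fin v) → Prop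
  | (true, x), (true, y) => inn adj x y
  | (false, x), (false, y) => inn adj x y
  | (true, x), (false, y) => ∃ i ∈ I x.2, ∀ j ∈ I y.2, R i j = true
  | (false, y), (true, x) => ¬ ∃ i ∈ I x.2, ∀ j ∈ I y.2, R i j = true

lemma crossRel_same {s v n : ℕ} (adj : Fin v → Fin v → Prop) (I : Fin v → Finset (Fin n))
    (R : Fin n → Fin n → Bool) (b : Bool) (x y : Bool × (Fin s × Fin v)) (hx : x.1 = b)
    (hy : y.1 = b) : crossRel adj I R x y ↔ inn adj x.2 y.2 := by
  rcases x with ⟨x1, x2⟩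
  rcases y with ⟨y1, y2⟩
  simp only at hx hy
  subst hx; subst hy
  cases y1 <;> simp [crossRel]

lemma crossRel_irrefl {s v n : ℕ} (adj : Fin v → Fin v → Prop) (I : Fin v → Finset (Fin n))
    (R : Fin n → Fin n → Bool) (x : Bool × (Fin s × Fin v)) : ¬ crossRel adj I R x x := by
  rw [crossRel_same adj I R x.1 x x rfl rfl]
  exact inn_irrefl adj x.2

lemma crossRel_total {s v n : ℕ} (adj : Fin v → Fin v → Prop) (I : Fin v → Finset (Fin n))
    (R : Fin n → Fin n → Bool) (hs : ∀ p q, adj p q → adj q p)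
    (x y : Bool × (Fin s × Fin v)) (h : x ≠ y) :
    crossRel adj I R x y ↔ ¬ crossRel adj I R y x := by
  by_cases hxy : x.1 = y.1
  · rw [crossRel_same adj I R y.1 x y hxy rfl, crossRel_same adj I R y.1 y x rfl hxy]
    exact inn_total adj hs _ _ (fun h' => h (Prod.ext hxy h'))
  · rcases x with ⟨x1, x2⟩
    rcases y with ⟨y1, y2⟩
    cases x1 <;> cases y1 <;> simp only [crossRel, not_not] <;> simp at hxy


/-- For every positive integer χ there are arbitrarily large N for which
there is an N-vertex tournament T with disjoint vertex subsets A, B with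
χ(T[A]), χ(T[B]) ≥ χ, yet for all A' ⊆ A, B' ⊆ B of size at most (log N)/(32χ²) both
χ(T[A ∩ N⁺(B')]) ≤ 2 and χ(T[B ∩ N⁺(A')]) ≤ 2. -/
theorem stmt_2 (χ : ℕ) (hχ : 1 ≤ χ) (M : ℕ) :
    ∃ N : ℕ, M ≤ N ∧
      ∃ (r : Fin N → Fin N → Prop) (A B : Set (Fin N)),
        IsTournament r ∧
        Disjoint A B ∧
        χ ≤ tournChromOn r A ∧
        χ ≤ tournChromOn r B ∧
        (∀ A' : Finset (Fin N), ↑A' ⊆ A →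
          (A'.card : ℝ) ≤ Real.log N / (32 * (χ : ℝ) ^ 2) →
          tournChromOn r (B ∩ {u | ∃ v ∈ A', r v u}) ≤ 2) ∧
        (∀ B' : Finset (Fin N), ↑B' ⊆ B →
          (B'.card : ℝ) ≤ Real.log N / (32 * (χ : ℝ) ^ 2) →
          tournChromOn r (A ∩ {u | ∃ v ∈ B', r v u}) ≤ 2) := by
  obtain ⟨q, hq⟩ : ∃ q, q = χ + M + 1 := ⟨_, rfl⟩
  have hq1 : 1 ≤ q := by omega
  have hp : 2 ^ (16 * q) = 2 * 2 ^ (16 * q - 1) := by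
    rw [← pow_succ']; congr 1; omega
  have hr0 : 1 ≤ 2 ^ (16 * q - 1) := Nat.one_le_two_pow
  obtain ⟨r0, hr0d⟩ : ∃ r0, r0 = 2 ^ (16 * q - 1) := ⟨_, rfl⟩
  rw [← hr0d] at hp hr0
  obtain ⟨n, hn⟩ : ∃ n, n + 1 = 2 * r0 + χ := ⟨2 * r0 + χ - 1, by omega⟩
  have hn1 : 2 ^ (16 * q) ≤ n := by omega
  have hn2 : n + 1 ≤ 2 ^ (17 * q) := by
    have h1 : q < 2 ^ q := Nat.lt_two_pow_self
    have h2 : 2 ^ (17 * q) = 2 ^ (16 * q) * 2 ^ q := by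
      rw [← pow_add]; congr 1; ring
    have h3 : q < 2 ^ (16 * q) := lt_of_lt_of_le h1 (Nat.pow_le_pow_right (by norm_num) (by omega))
    have h4 : 2 ≤ 2 ^ q := by omega
    have h5 : 2 ^ (16 * q) * 2 ≤ 2 ^ (17 * q) := by rw [h2]; exact Nat.mul_le_mul_left _ h4
    omega
  have hMn : M ≤ n := by
    have h1 : q < 2 ^ q := Nat.lt_two_pow_self
    have h3 : q < 2 ^ (16 * q) := lt_of_lt_of_le h1 (Nat.pow_le_pow_right (by norm_num) (by omega))
    omega
  obtain ⟨v, adj, I, col, hs, hi, hI, hcol, hchr, hv⟩ := graph_ex χ r0 n hr0 hn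
  obtain ⟨R, hR1, hR2⟩ := matrix_ex n q (numeric n q hq1 hn1 hn2)
  have hv1 : 1 ≤ v := by
    rcases Nat.eq_zero_or_pos v with h | h
    · subst h
      have := hchr 0 (fun x => x) (fun p => p.elim0)
      omega
    · exact h
  have hnχ : n + 1 ≤ (n + 1) ^ χ := Nat.le_self_pow (by omega) _
  obtain ⟨P, hP⟩ : ∃ P, P = (n + 1) ^ χ := ⟨_, rfl⟩
  rw [← hP] at hv hnχ
  obtain ⟨s, hsd⟩ : ∃ s, s = χ * (2 * P) := ⟨_, rfl⟩
  have hsP : P ≤ s := by rw [hsd]; nlinarith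
  have hsv : ∀ C, C < χ → C * v < s := by
    intro C hC
    rw [hsd]
    calc C * v ≤ C * (2 * P) := Nat.mul_le_mul_left _ hv
      _ < χ * (2 * P) := Nat.mul_lt_mul_of_pos_right hC (by omega)
  have hsvs : s ≤ s * v := Nat.le_mul_of_pos_right _ hv1
  have hNup : 2 * (s * v) ≤ 8 * χ * (n + 1) ^ (2 * χ) := by
    have h1 : (n + 1) ^ (2 * χ) = P * P := by rw [hP, ← pow_add]; congr 1; ring
    rw [h1]
    calc 2 * (s * v) ≤ 2 * (s * (2 * P)) := by gcongr
      _ = 8 * χ * (P * P) := by rw [hsd]; ring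
  have hcard : Fintype.card (Bool × (Fin s × Fin v)) = 2 * (s * v) := by simp
  obtain ⟨N, hN⟩ : ∃ N, N = 2 * (s * v) := ⟨_, rfl⟩
  rw [← hN] at hcard hNup
  have e : Fin N ≃ Bool × (Fin s × Fin v) := (Fintype.equivFinOfCardEq hcard).symm
  have hsame : ∀ b, ∀ u w, (e u).1 = b → (e w).1 = b →
      (crossRel adj I R (e u) (e w) ↔ inn adj (e u).2 (e w).2) :=
    fun b u w hu hw => crossRel_same adj I R b _ _ hu hw
  have hJ : ∀ A' : Finset (Fin N), (A'.card : ℝ) ≤ Real.log N / (32 * (χ : ℝ) ^ 2) →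
      (A'.biUnion (fun u => I (e u).2.2)).card ≤ q := by
    intro A' hA'
    refine le_trans (Finset.card_biUnion_le_card_mul A' _ χ (fun u _ => hI _)) ?_
    exact size_bound χ q n N _ hχ hq1 (by omega) hn2 hNup hA'
  refine ⟨N, by omega, fun u w => crossRel adj I R (e u) (e w), {u | (e u).1 = true},
    {u | (e u).1 = false}, ⟨fun u => crossRel_irrefl adj I R _, fun u w h =>
      crossRel_total adj I R hs _ _ (fun h' => h (e.injective h'))⟩, ?_, ?_, ?_, ?_, ?_⟩
  · rw [Set.disjoint_left]
    intro u hu hu'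
    simp only [Set.mem_setOf_eq] at hu hu'
    rw [hu] at hu'
    cases hu'
  · exact chrom_lower (fun u => crossRel_irrefl adj I R _) e adj hs hi true (hsame true) hchr hsv
  · exact chrom_lower (fun u => crossRel_irrefl adj I R _) e adj hs hi false (hsame false) hchr hsv
  · intro A' hA' hc
    obtain ⟨j, hj⟩ := hR2 _ (hJ A' hc)
    have key : ∀ u ∈ ({u | (e u).1 = false} ∩ {u | ∃ v ∈ A', crossRel adj I R (e v) (e u)} :
        Set (Fin N)), j ∉ I (e u).2.2 := by
      rintro u ⟨hu, a, ha, hau⟩ hju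
      have ha1 : (e a).1 = true := hA' ha
      have hu1 : (e u).1 = false := hu
      have hj' : ∀ i ∈ I (e a).2.2, R i j = false := fun i hi' =>
        hj i (Finset.mem_biUnion.2 ⟨a, ha, hi'⟩)
      generalize e a = x at *
      generalize e u = y at *
      rcases x with ⟨x1, x2⟩
      rcases y with ⟨y1, y2⟩
      simp only at ha1 hu1
      subst ha1; subst hu1
      obtain ⟨i, hi1, hi2⟩ := hau
      have h1 := hj' i hi1
      rw [hi2 j hju] at h1
      cases h1
    exact chrom_upper e adj false _ (hsame false) (fun u hu => hu.1) (col j)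
      (fun u hu w hw h => hcol j _ _ h (key u hu) (key w hw))
  · intro B' hB' hc
    obtain ⟨i, hi'⟩ := hR1 _ (hJ B' hc)
    have key : ∀ u ∈ ({u | (e u).1 = true} ∩ {u | ∃ v ∈ B', crossRel adj I R (e v) (e u)} :
        Set (Fin N)), i ∉ I (e u).2.2 := by
      rintro u ⟨hu, a, ha, hau⟩ hju
      have ha1 : (e a).1 = false := hB' ha
      have hu1 : (e u).1 = true := hu
      have hj' : ∀ j ∈ I (e a).2.2, R i j = true := fun j hj =>
        hi' j (Finset.mem_biUnion.2 ⟨a, ha, hj⟩)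
      generalize e a = x at *
      generalize e u = y at *
      rcases x with ⟨x1, x2⟩
      rcases y with ⟨y1, y2⟩
      simp only at ha1 hu1
      subst ha1; subst hu1
      exact hau ⟨i, hju, hj'⟩
    exact chrom_upper e adj true _ (hsame true) (fun u hu => hu.1) (col i)
      (fun u hu w hw h => hcol i _ _ h (key u hu) (key w hw))
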